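/- Let t012, t210, e01, e10 be positive real numbers. Define column vectors V₀ = (1,0,0)ᵗ, V₁ = (0,1,0)ᵗ, U₂ = ((e10³+1)·t012², (e01³+1)·e10³, −e10³·t012)ᵗ, and row vectors v₀ = (0, t012, 1), v₁ = (1, 0, t012), u₂ = (e01³·e10³, t012²·t210³, t012·(e01³·t210³ + t210³ + e01³·e10³ + e01³)). Let Y be the 3×3 matrix with columns U₂, V₁, V₀ (in this order), let y be the 3×3 matrix with rows u₂, v₁, v₀ (in this order), and set M = y·Y. Then: (a) u₂·U₂ = 0; (b) all six off-diagonal entries of M are positive; and (c) M₀₁·M₁₂·M₂₀ = t210³·(M₀₂·M₁₀·M₂₁), i.e., the triple ratio (M₀₁·M₁₂·M₂₀)/(M₀₂·M₁₀·M₂₁) equals t210³. -/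

import Mathlib

open Matrix

/-- The vertex vector `V₀`. -/
def Vzero : Fin 3 → ℝ := ![1, 0, 0]

/-- The vertex vector `V₁`. -/
def Vone : Fin 3 → ℝ := ![0, 1, 0]

/-- The vertex vector `U₂`. -/
def Utwo (t012 e01 e10 : ℝ) : Fin 3 → ℝ :=
  ![(e10 ^ 3 + 1) * t012 ^ 2, (e01 ^ 3 + 1) * e10 ^ 3, -(e10 ^ 3) * t012]

/-- The covector `v₀`. -/
def vzero (t012 : ℝ) : Fin 3 → ℝ := ![0, t012, 1]

/-- The covector `v₁`. -/
def vone (t012 : ℝ) : Fin 3 → ℝ := ![1, 0, t012]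

/-- The covector `u₂`. -/
def utwo (t012 t210 e01 e10 : ℝ) : Fin 3 → ℝ :=
  ![e01 ^ 3 * e10 ^ 3, t012 ^ 2 * t210 ^ 3,
    t012 * (e01 ^ 3 * t210 ^ 3 + t210 ^ 3 + e01 ^ 3 * e10 ^ 3 + e01 ^ 3)]

/-- The matrix `Y` whose columns are `U₂, V₁, V₀`. -/
def Ymat (t012 e01 e10 : ℝ) : Matrix (Fin 3) (Fin 3) ℝ :=
  Matrix.of fun i j => ![Utwo t012 e01 e10, Vone, Vzero] j i

/-- The matrix `y` whose rows are `u₂, v₁, v₀`. -/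
def ymat (t012 t210 e01 e10 : ℝ) : Matrix (Fin 3) (Fin 3) ℝ :=
  Matrix.of fun i j => ![utwo t012 t210 e01 e10, vone t012, vzero t012] i j

theorem ymat_mul_Ymat (t012 t210 e01 e10 : ℝ) :
    ymat t012 t210 e01 e10 * Ymat t012 e01 e10 =
      !![0, t012 ^ 2 * t210 ^ 3, e01 ^ 3 * e10 ^ 3;
         t012 ^ 2, 0, 1;
         t012 * (e01 ^ 3 * e10 ^ 3), t012, 0] := by
  ext i j
  fin_cases i <;> fin_cases j <;>
    simp [ymat, Ymat, utwo, vone, vzero, Utwo, Vone, Vzero, Matrix.mul_apply,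
      Fin.sum_univ_three] <;> ring

theorem stmt_4 (t012 t210 e01 e10 : ℝ)
    (ht012 : 0 < t012) (ht210 : 0 < t210) (he01 : 0 < e01) (he10 : 0 < e10)
    (M : Matrix (Fin 3) (Fin 3) ℝ)
    (hM : M = ymat t012 t210 e01 e10 * Ymat t012 e01 e10) :
    utwo t012 t210 e01 e10 ⬝ᵥ Utwo t012 e01 e10 = 0 ∧
    (∀ i j : Fin 3, i ≠ j → 0 < M i j) ∧
    M 0 1 * M 1 2 * M 2 0 = t210 ^ 3 * (M 0 2 * M 1 0 * M 2 1) := by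
  subst hM
  rw [ymat_mul_Ymat]
  refine ⟨?_, ?_, ?_⟩
  · simp [utwo, Utwo, dotProduct, Fin.sum_univ_three]
    ring
  · intro i j hij
    fin_cases i <;> fin_cases j <;> first | exact absurd rfl hij | (simp; try positivity)
  · simp
    ring
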